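/- arXiv:2404.13075 — 2 statements merged into one kernel-verified Lean document; each statement's English description precedes it below -/
import Mathlib

section
/- For all (s,t,w) ∈ ℝ³, the coefficients of the first fundamental form of the tubular hypersurface T, namely g₁₁ = ⟨∂T/∂s, ∂T/∂s⟩, g₁₂ = ⟨∂T/∂s, ∂T/∂t⟩, g₂₂ = ⟨∂T/∂t, ∂T/∂t⟩, g₁₃ = ⟨∂T/∂s, ∂T/∂w⟩, g₂₃ = ⟨∂T/∂t, ∂T/∂w⟩, g₃₃ = ⟨∂T/∂w, ∂T/∂w⟩, are given by: g₁₁ = -(1 + r k₁ cos t cos w)² + (r k₂ cos t cos w - r k₃ sin w)² + r²(k₂² + k₃²) sin²t cos²w, g₁₂ = r²(k₂ cos w - k₃ cos t sin w) cos w, g₂₂ = r² cos²w, g₁₃ = r² k₃ sin t, g₂₃ = 0, and g₃₃ = r². -/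
noncomputable section

open Real

set_option linter.unusedVariables false

/-- Minkowski inner product on `ℝ⁴` with signature `(-,+,+,+)`. -/
def mink (u v : Fin 4 → ℝ) : ℝ :=
  -(u 0 * v 0) + u 1 * v 1 + u 2 * v 2 + u 3 * v 3

/-- Gauss map of the tubular hypersurface about a timelike curve. -/
def gaussN (F₂ F₃ F₄ : ℝ → Fin 4 → ℝ) (s t w : ℝ) : Fin 4 → ℝ :=
  -((cos t * cos w) • F₂ s + (sin t * cos w) • F₃ s + (sin w) • F₄ s)

/-- The tubular hypersurface about a timelike curve. -/
def tubeT (r : ℝ) (β F₂ F₃ F₄ : ℝ → Fin 4 → ℝ) (s t w : ℝ) : Fin 4 → ℝ :=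
  β s + r • ((cos t * cos w) • F₂ s + (sin t * cos w) • F₃ s + (sin w) • F₄ s)

/-- The function `D(s,t,w) = 1 + r k₁(s) cos t cos w`. -/
def Dfun (r : ℝ) (k₁ : ℝ → ℝ) (s t w : ℝ) : ℝ := 1 + r * k₁ s * cos t * cos w

/-- The Cheng–Yau operator `ℒ₁` applied to the Gauss map of the tubular hypersurface. -/
def L1N (r : ℝ) (k₁ k₂ : ℝ → ℝ) (F₁ F₂ F₃ F₄ : ℝ → Fin 4 → ℝ) (s t w : ℝ) : Fin 4 → ℝ :=
  (-2 * (deriv k₁ s * cos t + k₁ s * k₂ s * sin t) * cos w / (r * (Dfun r k₁ s t w) ^ 3)) • F₁ s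
  + (-2 * (r * k₁ s * (3 * r * k₁ s * cos t ^ 3 * cos w ^ 3 + 2 * cos t ^ 2 * cos (2 * w)
      + cos (2 * t)) + cos t * cos w) / (r ^ 3 * (Dfun r k₁ s t w) ^ 2)) • F₂ s
  + (-2 * (1 + 3 * r * k₁ s * cos t * cos w) * sin t * cos w / (r ^ 3 * Dfun r k₁ s t w)) • F₃ s
  + (-2 * (1 + 3 * r * k₁ s * cos t * cos w) * sin w / (r ^ 3 * Dfun r k₁ s t w)) • F₄ s

/-- The operator `ℒ₂` applied to the Gauss map of the tubular hypersurface. -/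
def L2N (r : ℝ) (k₁ k₂ : ℝ → ℝ) (F₁ F₂ F₃ F₄ : ℝ → Fin 4 → ℝ) (s t w : ℝ) : Fin 4 → ℝ :=
  ((deriv k₁ s * cos t + k₁ s * k₂ s * sin t) * cos w / (r ^ 2 * (Dfun r k₁ s t w) ^ 3)) • F₁ s
  + (k₁ s * ((r * k₁ s / 2) * (24 * r * k₁ s * cos t ^ 4 * cos w ^ 4
      + 12 * cos t ^ 3 * cos (3 * w) + 19 * cos t * cos w + 9 * cos (3 * t) * cos w)
      + 6 * cos t ^ 2 * cos (2 * w) + 3 * cos (2 * t) - 1)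
      / (4 * r ^ 3 * (Dfun r k₁ s t w) ^ 3)) • F₂ s
  + (3 * k₁ s * sin t * cos t * cos w ^ 2 / (r ^ 3 * Dfun r k₁ s t w)) • F₃ s
  + (3 * k₁ s * cos t * sin w * cos w / (r ^ 3 * Dfun r k₁ s t w)) • F₄ s

/-- Minkowski inner product of two linear combinations of an orthonormal frame whose first vector
is timelike. -/
theorem mink_frame_combination {e₁ e₂ e₃ e₄ : Fin 4 → ℝ}
    (h₁₁ : mink e₁ e₁ = -1) (h₂₂ : mink e₂ e₂ = 1) (h₃₃ : mink e₃ e₃ = 1) (h₄₄ : mink e₄ e₄ = 1)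
    (h₁₂ : mink e₁ e₂ = 0) (h₁₃ : mink e₁ e₃ = 0) (h₁₄ : mink e₁ e₄ = 0)
    (h₂₃ : mink e₂ e₃ = 0) (h₂₄ : mink e₂ e₄ = 0) (h₃₄ : mink e₃ e₄ = 0)
    (a₁ a₂ a₃ a₄ b₁ b₂ b₃ b₄ : ℝ) :
    mink (a₁ • e₁ + a₂ • e₂ + a₃ • e₃ + a₄ • e₄) (b₁ • e₁ + b₂ • e₂ + b₃ • e₃ + b₄ • e₄)
      = -(a₁ * b₁) + a₂ * b₂ + a₃ * b₃ + a₄ * b₄ := by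
  simp only [mink, Pi.add_apply, Pi.smul_apply, smul_eq_mul] at *
  linear_combination (a₁ * b₁) * h₁₁ + (a₂ * b₂) * h₂₂ + (a₃ * b₃) * h₃₃ + (a₄ * b₄) * h₄₄
    + (a₁ * b₂ + a₂ * b₁) * h₁₂ + (a₁ * b₃ + a₃ * b₁) * h₁₃ + (a₁ * b₄ + a₄ * b₁) * h₁₄
    + (a₂ * b₃ + a₃ * b₂) * h₂₃ + (a₂ * b₄ + a₄ * b₂) * h₂₄ + (a₃ * b₄ + a₄ * b₃) * h₃₄

/-- The derivative of the tubular hypersurface along the curve parameter. -/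
theorem hasDerivAt_tubeT_curve {β F₂ F₃ F₄ : ℝ → Fin 4 → ℝ} {β' F₂' F₃' F₄' : Fin 4 → ℝ} {s : ℝ}
    (hβ : HasDerivAt β β' s) (h₂ : HasDerivAt F₂ F₂' s) (h₃ : HasDerivAt F₃ F₃' s)
    (h₄ : HasDerivAt F₄ F₄' s) (r t w : ℝ) :
    HasDerivAt (fun x => tubeT r β F₂ F₃ F₄ x t w)
      (β' + r • ((cos t * cos w) • F₂' + (sin t * cos w) • F₃' + sin w • F₄')) s :=
  hβ.add ((((h₂.const_smul (cos t * cos w)).add (h₃.const_smul (sin t * cos w))).add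
    (h₄.const_smul (sin w))).const_smul r)

/-- The derivative of the tubular hypersurface along the first angle. -/
theorem hasDerivAt_tubeT_fst_angle (r : ℝ) (β F₂ F₃ F₄ : ℝ → Fin 4 → ℝ) (s t w : ℝ) :
    HasDerivAt (fun x => tubeT r β F₂ F₃ F₄ s x w)
      (r • ((-sin t * cos w) • F₂ s + (cos t * cos w) • F₃ s)) t :=
  ((((((hasDerivAt_cos t).mul_const _).smul_const _).add
    (((hasDerivAt_sin t).mul_const _).smul_const _)).add_const _).const_smul r).const_add _

/-- The derivative of the tubular hypersurface along the second angle. -/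
theorem hasDerivAt_tubeT_snd_angle (r : ℝ) (β F₂ F₃ F₄ : ℝ → Fin 4 → ℝ) (s t w : ℝ) :
    HasDerivAt (fun x => tubeT r β F₂ F₃ F₄ s t x)
      (r • ((cos t * -sin w) • F₂ s + (sin t * -sin w) • F₃ s + cos w • F₄ s)) w :=
  ((((((hasDerivAt_cos w).const_mul _).smul_const _).add
    (((hasDerivAt_cos w).const_mul _).smul_const _)).add
    ((hasDerivAt_sin w).smul_const _)).const_smul r).const_add _

theorem first_fundamental_form_timelike
    (r : ℝ) (hr : 0 < r)
    (β F₁ F₂ F₃ F₄ : ℝ → Fin 4 → ℝ) (k₁ k₂ k₃ : ℝ → ℝ)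
    (hβ : ContDiff ℝ (⊤ : ℕ∞) β) (hF₁ : ContDiff ℝ (⊤ : ℕ∞) F₁) (hF₂ : ContDiff ℝ (⊤ : ℕ∞) F₂)
    (hF₃ : ContDiff ℝ (⊤ : ℕ∞) F₃) (hF₄ : ContDiff ℝ (⊤ : ℕ∞) F₄)
    (hk₁ : ContDiff ℝ (⊤ : ℕ∞) k₁) (hk₂ : ContDiff ℝ (⊤ : ℕ∞) k₂) (hk₃ : ContDiff ℝ (⊤ : ℕ∞) k₃)
    (hβ' : ∀ s, deriv β s = F₁ s)
    (hF₁₁ : ∀ s, mink (F₁ s) (F₁ s) = -1)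
    (hF₂₂ : ∀ s, mink (F₂ s) (F₂ s) = 1)
    (hF₃₃ : ∀ s, mink (F₃ s) (F₃ s) = 1)
    (hF₄₄ : ∀ s, mink (F₄ s) (F₄ s) = 1)
    (hF₁₂ : ∀ s, mink (F₁ s) (F₂ s) = 0)
    (hF₁₃ : ∀ s, mink (F₁ s) (F₃ s) = 0)
    (hF₁₄ : ∀ s, mink (F₁ s) (F₄ s) = 0)
    (hF₂₃ : ∀ s, mink (F₂ s) (F₃ s) = 0)
    (hF₂₄ : ∀ s, mink (F₂ s) (F₄ s) = 0)
    (hF₃₄ : ∀ s, mink (F₃ s) (F₄ s) = 0)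
    (hFr₁ : ∀ s, deriv F₁ s = k₁ s • F₂ s)
    (hFr₂ : ∀ s, deriv F₂ s = k₁ s • F₁ s + k₂ s • F₃ s)
    (hFr₃ : ∀ s, deriv F₃ s = (-(k₂ s)) • F₂ s + k₃ s • F₄ s)
    (hFr₄ : ∀ s, deriv F₄ s = (-(k₃ s)) • F₃ s)
    :
    ∀ s t w : ℝ,
      mink (deriv (fun x => tubeT r β F₂ F₃ F₄ x t w) s) (deriv (fun x => tubeT r β F₂ F₃ F₄ x t w) s)
        = -(1 + r * k₁ s * cos t * cos w) ^ 2
          + (r * k₂ s * cos t * cos w - r * k₃ s * sin w) ^ 2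
          + r ^ 2 * ((k₂ s) ^ 2 + (k₃ s) ^ 2) * sin t ^ 2 * cos w ^ 2 ∧
      mink (deriv (fun x => tubeT r β F₂ F₃ F₄ x t w) s) (deriv (fun x => tubeT r β F₂ F₃ F₄ s x w) t)
        = r ^ 2 * (k₂ s * cos w - k₃ s * cos t * sin w) * cos w ∧
      mink (deriv (fun x => tubeT r β F₂ F₃ F₄ s x w) t) (deriv (fun x => tubeT r β F₂ F₃ F₄ s x w) t)
        = r ^ 2 * cos w ^ 2 ∧
      mink (deriv (fun x => tubeT r β F₂ F₃ F₄ x t w) s) (deriv (fun x => tubeT r β F₂ F₃ F₄ s t x) w)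
        = r ^ 2 * k₃ s * sin t ∧
      mink (deriv (fun x => tubeT r β F₂ F₃ F₄ s x w) t) (deriv (fun x => tubeT r β F₂ F₃ F₄ s t x) w)
        = 0 ∧
      mink (deriv (fun x => tubeT r β F₂ F₃ F₄ s t x) w) (deriv (fun x => tubeT r β F₂ F₃ F₄ s t x) w)
        = r ^ 2 := by
  intro s t w
  have hasDeriv {f : ℝ → Fin 4 → ℝ} (hf : ContDiff ℝ (⊤ : ℕ∞) f) : HasDerivAt f (deriv f s) s :=
    (hf.differentiable (by simp)).differentiableAt.hasDerivAt
  have hs : deriv (fun x => tubeT r β F₂ F₃ F₄ x t w) s =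
      (1 + r * k₁ s * cos t * cos w) • F₁ s + (-(r * k₂ s * sin t * cos w)) • F₂ s
        + (r * k₂ s * cos t * cos w - r * k₃ s * sin w) • F₃ s
        + (r * k₃ s * sin t * cos w) • F₄ s := by
    rw [(hasDerivAt_tubeT_curve (hasDeriv hβ) (hasDeriv hF₂) (hasDeriv hF₃) (hasDeriv hF₄)
      r t w).deriv, hβ', hFr₂, hFr₃, hFr₄]
    module
  have ht : deriv (fun x => tubeT r β F₂ F₃ F₄ s x w) t =
      (0 : ℝ) • F₁ s + (-(r * sin t * cos w)) • F₂ s + (r * cos t * cos w) • F₃ s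
        + (0 : ℝ) • F₄ s := by
    rw [(hasDerivAt_tubeT_fst_angle r β F₂ F₃ F₄ s t w).deriv]
    module
  have hw : deriv (fun x => tubeT r β F₂ F₃ F₄ s t x) w =
      (0 : ℝ) • F₁ s + (-(r * cos t * sin w)) • F₂ s + (-(r * sin t * sin w)) • F₃ s
        + (r * cos w) • F₄ s := by
    rw [(hasDerivAt_tubeT_snd_angle r β F₂ F₃ F₄ s t w).deriv]
    module
  have hmink := mink_frame_combination (hF₁₁ s) (hF₂₂ s) (hF₃₃ s) (hF₄₄ s) (hF₁₂ s) (hF₁₃ s)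
    (hF₁₄ s) (hF₂₃ s) (hF₂₄ s) (hF₃₄ s)
  have htrig := sin_sq_add_cos_sq t
  have hwtrig := sin_sq_add_cos_sq w
  simp only [hs, ht, hw, hmink]
  refine ⟨?_, ?_, ?_, ?_, ?_, ?_⟩
  · ring
  · linear_combination r ^ 2 * k₂ s * cos w ^ 2 * htrig
  · linear_combination r ^ 2 * cos w ^ 2 * htrig
  · linear_combination r ^ 2 * k₃ s * sin t * hwtrig
  · ring
  · linear_combination r ^ 2 * sin w ^ 2 * htrig + r ^ 2 * hwtrig
end
end

section
/- For every j ∈ {2,3,4} and λ ∈ {1,-1} and all (s,t,w) ∈ ℝ³, the field N(s,t,w) = -σ·λ^j·(μ₂(t,w)F₂(s) + μ₃(t,w)F₃(s) + μ₄(t,w)F₄(s)) satisfies ⟨N(s,t,w), N(s,t,w)⟩ = λ and ⟨N(s,t,w), ∂T/∂s(s,t,w)⟩ = ⟨N(s,t,w), ∂T/∂t(s,t,w)⟩ = ⟨N(s,t,w), ∂T/∂w(s,t,w)⟩ = 0; that is, N is a unit normal vector field of the tubular hypersurface T^{j,λ}, spacelike when λ = 1 and timelike when λ = -1. -/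
noncomputable section

open Real

set_option linter.unusedVariables false

/-- `εᵢ = ⟨Fᵢ,Fᵢ⟩` : equals `-1` if `i = j` and `1` otherwise. -/
def eps (j i : ℕ) : ℝ := if i = j then -1 else 1

/-- `σ = 1` if `j = 2` and `σ = -1` if `j ∈ {3,4}`. -/
def sigma' (j : ℕ) : ℝ := if j = 2 then 1 else -1

/-- `τ = 1` if `j ∈ {2,3}` and `τ = -1` if `j = 4`. -/
def tau' (j : ℕ) : ℝ := if j = 4 then -1 else 1

/-- The functions `μ₂, μ₃, μ₄` defined by the cyclic index rule
(`μ₅ := μ₂`, `μ₆ := μ₃`): `μⱼ = cosh t·sinh w`, `μⱼ₊₁ = cosh w`,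
`μⱼ₊₂ = sinh t·sinh w` if `λ = 1`, and `μⱼ = cosh t·cosh w`,
`μⱼ₊₁ = sinh w`, `μⱼ₊₂ = sinh t·cosh w` if `λ = -1`. -/
def mu (j : ℕ) (lam : ℝ) (i : ℕ) (t w : ℝ) : ℝ :=
  if (i + 3 - j) % 3 = 0 then cosh t * (if lam = 1 then sinh w else cosh w)
  else if (i + 3 - j) % 3 = 1 then (if lam = 1 then cosh w else sinh w)
  else sinh t * (if lam = 1 then sinh w else cosh w)

/-- Gauss map of the tubular hypersurface `T^{j,λ}` about a spacelike curve of type `j`. -/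
def gaussNJ (j : ℕ) (lam : ℝ) (F₂ F₃ F₄ : ℝ → Fin 4 → ℝ) (s t w : ℝ) : Fin 4 → ℝ :=
  (-(sigma' j) * lam ^ j) •
    (mu j lam 2 t w • F₂ s + mu j lam 3 t w • F₃ s + mu j lam 4 t w • F₄ s)

/-- The tubular hypersurface `T^{j,λ}` about a spacelike curve of type `j`. -/
def tubeTJ (j : ℕ) (lam r : ℝ) (β F₂ F₃ F₄ : ℝ → Fin 4 → ℝ) (s t w : ℝ) : Fin 4 → ℝ :=
  β s + r • (mu j lam 2 t w • F₂ s + mu j lam 3 t w • F₃ s + mu j lam 4 t w • F₄ s)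

/-- The function `D(s,t,w) = σ + r k₁(s) μ₂(t,w)`. -/
def DJ (j : ℕ) (lam r : ℝ) (k₁ : ℝ → ℝ) (s t w : ℝ) : ℝ :=
  sigma' j + r * k₁ s * mu j lam 2 t w

/-- The Cheng–Yau operator `ℒ₁` applied to the Gauss map of `T^{j,λ}`. -/
def L1NJ (j : ℕ) (lam r : ℝ) (k₁ k₂ : ℝ → ℝ) (F₁ F₂ F₃ F₄ : ℝ → Fin 4 → ℝ)
    (s t w : ℝ) : Fin 4 → ℝ :=
  (2 * (-(tau' j) * k₁ s * k₂ s * mu j lam 3 t w + deriv k₁ s * mu j lam 2 t w)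
      / (r * (DJ j lam r k₁ s t w) ^ 3)) • F₁ s
  + (-2 * lam * (mu j lam 2 t w + 3 * r ^ 2 * (k₁ s) ^ 2 * (mu j lam 2 t w) ^ 3
      + k₁ s * (lam * r + 4 * sigma' j * r * (mu j lam 2 t w) ^ 2))
      / (r ^ 3 * (DJ j lam r k₁ s t w) ^ 2)) • F₂ s
  + (-2 * lam * sigma' j * mu j lam 3 t w * (1 + 3 * sigma' j * r * k₁ s * mu j lam 2 t w)
      / (r ^ 3 * DJ j lam r k₁ s t w)) • F₃ s
  + (-2 * lam * mu j lam 4 t w * (sigma' j + 3 * r * k₁ s * mu j lam 2 t w)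
      / (r ^ 3 * DJ j lam r k₁ s t w)) • F₄ s

/-- The operator `ℒ₂` applied to the Gauss map of `T^{j,λ}`. -/
def L2NJ (j : ℕ) (lam r : ℝ) (k₁ k₂ : ℝ → ℝ) (F₁ F₂ F₃ F₄ : ℝ → Fin 4 → ℝ)
    (s t w : ℝ) : Fin 4 → ℝ :=
  (lam ^ j * ((-1 : ℝ) ^ j * mu j lam 3 t w * k₁ s * k₂ s - sigma' j * mu j lam 2 t w * deriv k₁ s)
      / (r ^ 2 * (DJ j lam r k₁ s t w) ^ 3)) • F₁ s
  + (-lam ^ (j + 1) * k₁ s * (2 * lam * sigma' j - 3 * (-1 : ℝ) ^ j * (mu j lam 4 t w) ^ 2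
      - 3 * tau' j * (mu j lam 3 t w) ^ 2 - 3 * sigma' j * r * k₁ s * (mu j lam 2 t w) ^ 3)
      / (r ^ 3 * (DJ j lam r k₁ s t w) ^ 2)) • F₂ s
  + (3 * tau' j * lam ^ (j + 1) * r * k₁ s * mu j lam 2 t w * mu j lam 3 t w
      / (r ^ 4 * (tau' j + (-1 : ℝ) ^ j * r * k₁ s * mu j lam 2 t w))) • F₃ s
  + (3 * tau' j * lam ^ (j + 1) * r * k₁ s * mu j lam 2 t w * mu j lam 4 t w
      / (r ^ 4 * (tau' j + (-1 : ℝ) ^ j * r * k₁ s * mu j lam 2 t w))) • F₄ s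

theorem eps_sq (j i : ℕ) : eps j i ^ 2 = 1 := by
  unfold eps
  split_ifs <;> norm_num

theorem sigma'_sq (j : ℕ) : sigma' j ^ 2 = 1 := by
  unfold sigma'
  split_ifs <;> norm_num

/-- The coefficients `μ₂, μ₃, μ₄` parametrise the quadric `∑ εᵢ μᵢ² = λ`. -/
theorem sum_eps_mul_mu_sq {j : ℕ} (hj : j = 2 ∨ j = 3 ∨ j = 4) {lam : ℝ}
    (hlam : lam = 1 ∨ lam = -1) (t w : ℝ) :
    eps j 2 * mu j lam 2 t w ^ 2 + eps j 3 * mu j lam 3 t w ^ 2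
      + eps j 4 * mu j lam 4 t w ^ 2 = lam := by
  have ht := cosh_sq t
  have hw := cosh_sq w
  have hne : (-1 : ℝ) ≠ 1 := by norm_num
  rcases hj with rfl | rfl | rfl <;> rcases hlam with rfl | rfl <;>
    norm_num [eps, mu, hne, mul_pow, ht, hw] <;> ring

theorem differentiable_mu_left (j : ℕ) (lam : ℝ) (i : ℕ) (w : ℝ) :
    Differentiable ℝ fun t => mu j lam i t w := by
  unfold mu
  split_ifs <;> fun_prop

theorem differentiable_mu_right (j : ℕ) (lam : ℝ) (i : ℕ) (t : ℝ) :
    Differentiable ℝ fun w => mu j lam i t w := by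
  unfold mu
  split_ifs <;> fun_prop

/-- A curve in the quadric `e₂ a² + e₃ b² + e₄ c² = q` has velocity orthogonal to its position. -/
theorem sum_mul_deriv_eq_zero_of_quadric {a b c : ℝ → ℝ} {a' b' c' e₂ e₃ e₄ q x : ℝ}
    (ha : HasDerivAt a a' x) (hb : HasDerivAt b b' x) (hc : HasDerivAt c c' x)
    (h : ∀ y, e₂ * a y ^ 2 + e₃ * b y ^ 2 + e₄ * c y ^ 2 = q) :
    e₂ * a x * a' + e₃ * b x * b' + e₄ * c x * c' = 0 := by
  have hd := (((ha.pow 2).const_mul e₂).add ((hb.pow 2).const_mul e₃)).add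
    ((hc.pow 2).const_mul e₄)
  have hq : HasDerivAt (fun _ : ℝ => q) _ x := hd.congr_of_eventuallyEq
    (Filter.Eventually.of_forall fun y => (h y).symm)
  have h0 := hq.unique (hasDerivAt_const x q)
  norm_num at h0
  linarith

theorem mink_frame_combination_s19 {f₁ f₂ f₃ f₄ : Fin 4 → ℝ} {e₂ e₃ e₄ : ℝ}
    (h₂₂ : mink f₂ f₂ = e₂) (h₃₃ : mink f₃ f₃ = e₃) (h₄₄ : mink f₄ f₄ = e₄)
    (h₁₂ : mink f₁ f₂ = 0) (h₁₃ : mink f₁ f₃ = 0) (h₁₄ : mink f₁ f₄ = 0)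
    (h₂₃ : mink f₂ f₃ = 0) (h₂₄ : mink f₂ f₄ = 0) (h₃₄ : mink f₃ f₄ = 0)
    (m a b c p q u v : ℝ) :
    mink (m • (a • f₂ + b • f₃ + c • f₄)) (p • f₁ + q • f₂ + u • f₃ + v • f₄)
      = m * (e₂ * a * q + e₃ * b * u + e₄ * c * v) := by
  simp only [mink, Pi.add_apply, Pi.smul_apply, smul_eq_mul] at *
  linear_combination m * (a * q * h₂₂ + b * u * h₃₃ + c * v * h₄₄ + a * p * h₁₂ + b * p * h₁₃
    + c * p * h₁₄ + (a * u + b * q) * h₂₃ + (a * v + c * q) * h₂₄ + (b * v + c * u) * h₃₄)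

/-- The velocity of a curve `x ↦ z + r (a(x) f₂ + b(x) f₃ + c(x) f₄)`. -/
theorem hasDerivAt_const_add_smul_combination {a b c : ℝ → ℝ} {a' b' c' x : ℝ}
    (ha : HasDerivAt a a' x) (hb : HasDerivAt b b' x) (hc : HasDerivAt c c' x)
    (r : ℝ) (z f₁ f₂ f₃ f₄ : Fin 4 → ℝ) :
    HasDerivAt (fun y => z + r • (a y • f₂ + b y • f₃ + c y • f₄))
      ((0 : ℝ) • f₁ + (r * a') • f₂ + (r * b') • f₃ + (r * c') • f₄) x := by
  refine (((((ha.smul_const f₂).add (hb.smul_const f₃)).add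
    (hc.smul_const f₄)).const_smul r).const_add z).congr_deriv ?_
  module

theorem gauss_map_unit_normal_spacelike
    (j : ℕ) (hj : j = 2 ∨ j = 3 ∨ j = 4) (lam : ℝ) (hlam : lam = 1 ∨ lam = -1)
    (r : ℝ) (hr : 0 < r)
    (β F₁ F₂ F₃ F₄ : ℝ → Fin 4 → ℝ) (k₁ k₂ k₃ : ℝ → ℝ)
    (hβ : ContDiff ℝ (⊤ : ℕ∞) β) (hF₁ : ContDiff ℝ (⊤ : ℕ∞) F₁) (hF₂ : ContDiff ℝ (⊤ : ℕ∞) F₂)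
    (hF₃ : ContDiff ℝ (⊤ : ℕ∞) F₃) (hF₄ : ContDiff ℝ (⊤ : ℕ∞) F₄)
    (hk₁ : ContDiff ℝ (⊤ : ℕ∞) k₁) (hk₂ : ContDiff ℝ (⊤ : ℕ∞) k₂) (hk₃ : ContDiff ℝ (⊤ : ℕ∞) k₃)
    (hβ' : ∀ s, deriv β s = F₁ s)
    (hF₁₁ : ∀ s, mink (F₁ s) (F₁ s) = eps j 1)
    (hF₂₂ : ∀ s, mink (F₂ s) (F₂ s) = eps j 2)
    (hF₃₃ : ∀ s, mink (F₃ s) (F₃ s) = eps j 3)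
    (hF₄₄ : ∀ s, mink (F₄ s) (F₄ s) = eps j 4)
    (hF₁₂ : ∀ s, mink (F₁ s) (F₂ s) = 0)
    (hF₁₃ : ∀ s, mink (F₁ s) (F₃ s) = 0)
    (hF₁₄ : ∀ s, mink (F₁ s) (F₄ s) = 0)
    (hF₂₃ : ∀ s, mink (F₂ s) (F₃ s) = 0)
    (hF₂₄ : ∀ s, mink (F₂ s) (F₄ s) = 0)
    (hF₃₄ : ∀ s, mink (F₃ s) (F₄ s) = 0)
    (hFr₁ : ∀ s, deriv F₁ s = k₁ s • F₂ s)
    (hFr₂ : ∀ s, deriv F₂ s = (-(eps j 1 * eps j 2) * k₁ s) • F₁ s + k₂ s • F₃ s)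
    (hFr₃ : ∀ s, deriv F₃ s = (-(eps j 2 * eps j 3) * k₂ s) • F₂ s + k₃ s • F₄ s)
    (hFr₄ : ∀ s, deriv F₄ s = (-(eps j 3 * eps j 4) * k₃ s) • F₃ s)
    :
    ∀ s t w : ℝ,
      mink (gaussNJ j lam F₂ F₃ F₄ s t w) (gaussNJ j lam F₂ F₃ F₄ s t w) = lam ∧
      mink (gaussNJ j lam F₂ F₃ F₄ s t w) (deriv (fun x => tubeTJ j lam r β F₂ F₃ F₄ x t w) s) = 0 ∧
      mink (gaussNJ j lam F₂ F₃ F₄ s t w) (deriv (fun x => tubeTJ j lam r β F₂ F₃ F₄ s x w) t) = 0 ∧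
      mink (gaussNJ j lam F₂ F₃ F₄ s t w) (deriv (fun x => tubeTJ j lam r β F₂ F₃ F₄ s t x) w) = 0 := by
  intro s t w
  have comb := mink_frame_combination_s19 (hF₂₂ s) (hF₃₃ s) (hF₄₄ s) (hF₁₂ s) (hF₁₃ s) (hF₁₄ s)
    (hF₂₃ s) (hF₂₄ s) (hF₃₄ s)
  refine ⟨?_, ?_, ?_, ?_⟩
  · have hm : (-(sigma' j) * lam ^ j) ^ 2 = 1 := by
      have hl : lam ^ 2 = 1 := by rcases hlam with rfl | rfl <;> norm_num
      rw [mul_pow, neg_sq, sigma'_sq, ← pow_mul, mul_comm j, pow_mul, hl, one_pow, one_mul]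
    have hQ := sum_eps_mul_mu_sq hj hlam t w
    unfold gaussNJ
    set m := -(sigma' j) * lam ^ j
    have := comb m (mu j lam 2 t w) (mu j lam 3 t w) (mu j lam 4 t w) 0
      (m * mu j lam 2 t w) (m * mu j lam 3 t w) (m * mu j lam 4 t w)
    rw [show (0 : ℝ) • F₁ s + (m * mu j lam 2 t w) • F₂ s + (m * mu j lam 3 t w) • F₃ s
      + (m * mu j lam 4 t w) • F₄ s = m • (mu j lam 2 t w • F₂ s + mu j lam 3 t w • F₃ s
      + mu j lam 4 t w • F₄ s) by module] at this
    rw [this]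
    linear_combination lam * hm + m ^ 2 * hQ
  · have dβ := (hβ.differentiable (by simp) s).hasDerivAt
    have d₂ := (hF₂.differentiable (by simp) s).hasDerivAt
    have d₃ := (hF₃.differentiable (by simp) s).hasDerivAt
    have d₄ := (hF₄.differentiable (by simp) s).hasDerivAt
    rw [hβ'] at dβ
    rw [hFr₂] at d₂
    rw [hFr₃] at d₃
    rw [hFr₄] at d₄
    have hd : deriv (fun x => tubeTJ j lam r β F₂ F₃ F₄ x t w) s = _ :=
      (dβ.add ((((d₂.const_smul (mu j lam 2 t w)).add (d₃.const_smul (mu j lam 3 t w))).add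
        (d₄.const_smul (mu j lam 4 t w))).const_smul r)).deriv
    have hv : deriv (fun x => tubeTJ j lam r β F₂ F₃ F₄ x t w) s
        = (1 - r * mu j lam 2 t w * (eps j 1 * eps j 2) * k₁ s) • F₁ s
          + (-r * mu j lam 3 t w * (eps j 2 * eps j 3) * k₂ s) • F₂ s
          + (r * (mu j lam 2 t w * k₂ s - mu j lam 4 t w * (eps j 3 * eps j 4) * k₃ s)) • F₃ s
          + (r * mu j lam 3 t w * k₃ s) • F₄ s := by
      rw [hd]
      module
    rw [hv, gaussNJ, comb]
    linear_combination (-(sigma' j) * lam ^ j) * r * mu j lam 3 t w *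
      (-(mu j lam 2 t w * k₂ s * eps j 3) * eps_sq j 2
        - mu j lam 4 t w * k₃ s * eps j 4 * eps_sq j 3)
  · have d := fun i => (differentiable_mu_left j lam i w t).hasDerivAt
    have h0 := sum_mul_deriv_eq_zero_of_quadric (d 2) (d 3) (d 4)
      fun y => sum_eps_mul_mu_sq hj hlam y w
    have hd : deriv (fun x => tubeTJ j lam r β F₂ F₃ F₄ s x w) t = _ :=
      (hasDerivAt_const_add_smul_combination (d 2) (d 3) (d 4)
        r (β s) (F₁ s) (F₂ s) (F₃ s) (F₄ s)).deriv
    rw [hd, gaussNJ, comb]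
    linear_combination (-(sigma' j) * lam ^ j) * r * h0
  · have d := fun i => (differentiable_mu_right j lam i t w).hasDerivAt
    have h0 := sum_mul_deriv_eq_zero_of_quadric (d 2) (d 3) (d 4)
      fun y => sum_eps_mul_mu_sq hj hlam t y
    have hd : deriv (fun x => tubeTJ j lam r β F₂ F₃ F₄ s t x) w = _ :=
      (hasDerivAt_const_add_smul_combination (d 2) (d 3) (d 4)
        r (β s) (F₁ s) (F₂ s) (F₃ s) (F₄ s)).deriv
    rw [hd, gaussNJ, comb]
    linear_combination (-(sigma' j) * lam ^ j) * r * h0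
end
end
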